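/- In the free associative algebra A over a field of characteristic zero, L_j · L_k ⊆ M_{j+k−1} whenever j or k is odd, where L_i is the lower central series and M_i is the two-sided ideal generated by L_i. -/

import Mathlib

/-- The commutator `[a,b] = a*b - b*a`. -/
def br {A : Type*} [Ring A] (a b : A) : A := a * b - b * a

/-- Lower central series: `lcs K A 1 = A`, `lcs K A (k+1) = span {[a,l] | a ∈ A, l ∈ lcs K A k}`. -/
def lcs (K : Type*) [Field K] (A : Type*) [Ring A] [Algebra K A] : ℕ → Submodule K A
  | 0 => ⊤
  | 1 => ⊤
  | (k+2) => Submodule.span K {x : A | ∃ a l : A, l ∈ lcs K A (k+1) ∧ x = a * l - l * a}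

/-- `mIdeal K A j = A·L_j·A`, the two-sided ideal generated by `L_j`. -/
def mIdeal (K : Type*) [Field K] (A : Type*) [Ring A] [Algebra K A] (j : ℕ) : Submodule K A :=
  Submodule.span K {x : A | ∃ a l b : A, l ∈ lcs K A j ∧ x = a * l * b}

theorem key_identity {A : Type*} [Ring A] (a l p q b : A) :
    (3 : ℤ) • br (a * br q (br p l)) b =
      (-1 : ℤ) • br b (br (a * q) (br p l))
      + (1 : ℤ) • br (q * b) (br a (br p l))
      + (1 : ℤ) • br (q * a) (br p (br b l))
      + (-1 : ℤ) • br b (br a (br q (p * l)))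
      + (-1 : ℤ) • br b (br q (br p (a * l)))
      + (2 : ℤ) • br (a * p) (br q (br b l))
      + (-1 : ℤ) • br q (br p (br b (a * l)))
      + (1 : ℤ) • br a (br q (br p (l * b)))
      + (1 : ℤ) • br (b * q) (br p (br a l))
      + (-1 : ℤ) • br q (br b (br a (p * l)))
      + (-1 : ℤ) • br b (br p (br a (q * l)))
      + (1 : ℤ) • br (b * p) (br a (br q l))
      + (-2 : ℤ) • br p (br b (br a (l * q)))
      + (2 : ℤ) • br (q * p) (br b (br a l))
      + (-2 : ℤ) • br p (br q (br b (l * a)))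
      + (-2 : ℤ) • br p (br a (br q (l * b)))
      + (-2 : ℤ) • br a (br (p * q) (br b l))
      + (-1 : ℤ) • br q (br a (br p (b * l)))
      + (1 : ℤ) • br a (br p (br b (l * q)))
      + (-1 : ℤ) • br (p * a) (br b (br q l))
      + (-1 : ℤ) • br q (br (p * b) (br a l))
      + (1 : ℤ) • br p (br (a * b) (br q l))
      + (1 : ℤ) • br a (br b (br q (l * p)))
      + (-1 : ℤ) • br (b * a) (br q (br p l)) := by
  simp only [br, mul_sub, sub_mul, ← mul_assoc]
  abel

theorem key_mem (K : Type*) [Field K] [CharZero K] {A : Type*} [Ring A] [Algebra K A]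
    (S : Submodule K A) (l : A)
    (h0 : ∀ x y z : A, br x (br y (br z l)) ∈ S)
    (hl : ∀ x y z w : A, br x (br y (br z (w * l))) ∈ S)
    (hr : ∀ x y z w : A, br x (br y (br z (l * w))) ∈ S)
    (a p q b : A) : br (a * br q (br p l)) b ∈ S := by
  have zm : ∀ (n : ℤ) {x : A}, x ∈ S → n • x ∈ S := fun n x hx => zsmul_mem hx n
  have h3 : (3 : ℤ) • br (a * br q (br p l)) b ∈ S := by
    rw [key_identity]
    repeat' with_reducible apply S.add_mem
    all_goals apply zm
    all_goals with_reducible first | exact h0 _ _ _ | exact hl _ _ _ _ | exact hr _ _ _ _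
  have h3' : (3 : K) • br (a * br q (br p l)) b ∈ S := by
    have e : (3 : K) • br (a * br q (br p l)) b = (3 : ℤ) • br (a * br q (br p l)) b := by
      rw [← Int.cast_smul_eq_zsmul K]; norm_num
    rw [e]; exact h3
  exact (S.smul_mem_iff (by norm_num : (3 : K) ≠ 0)).1 h3'

section LcsLemmas

variable {K : Type*} [Field K] {A : Type*} [Ring A] [Algebra K A]

theorem br_mem_lcs {k : ℕ} (hk : 1 ≤ k) (a : A) {l : A} (hl : l ∈ lcs K A k) :
    br a l ∈ lcs K A (k + 1) := by
  obtain ⟨k, rfl⟩ : ∃ m, k = m + 1 := ⟨k - 1, by omega⟩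
  exact Submodule.subset_span ⟨a, l, hl, rfl⟩

theorem br_swap (a b : A) : br a b = - br b a := by simp [br]

theorem br_mem_lcs' {k : ℕ} (hk : 1 ≤ k) (a : A) {l : A} (hl : l ∈ lcs K A k) :
    br l a ∈ lcs K A (k + 1) := by
  rw [br_swap]
  exact Submodule.neg_mem _ (br_mem_lcs hk a hl)

/-- Induction principle for the lower central series. -/
theorem lcs_induct {k : ℕ} (hk : 1 ≤ k) (f : A →ₗ[K] A) (S : Submodule K A)
    (h : ∀ a l : A, l ∈ lcs K A k → f (br a l) ∈ S) {x : A} (hx : x ∈ lcs K A (k + 1)) :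
    f x ∈ S := by
  obtain ⟨k, rfl⟩ : ∃ m, k = m + 1 := ⟨k - 1, by omega⟩
  have : lcs K A (k + 1 + 1) ≤ S.comap f := by
    refine Submodule.span_le.2 ?_
    rintro x ⟨a, l, hl, rfl⟩
    exact h a l hl
  exact this hx

/-- Left bracket as a linear map. -/
def brL (K : Type*) [Field K] {A : Type*} [Ring A] [Algebra K A] (x : A) : A →ₗ[K] A :=
  LinearMap.mulLeft K x - LinearMap.mulRight K x

theorem brL_apply (x y : A) : brL K x y = br x y := by simp [brL, br]

theorem lcs_anti {k : ℕ} (hk : 1 ≤ k) : lcs K A (k + 1) ≤ lcs K A k := by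
  induction k, hk using Nat.le_induction with
  | base => exact fun _ _ => Submodule.mem_top
  | succ k hk ih =>
    intro x hx
    exact lcs_induct (by omega) LinearMap.id _ (fun a l hl => br_mem_lcs hk a (ih hl)) hx

theorem br_jacobi (x a l : A) : br x (br a l) = br (br x a) l + br a (br x l) := by
  simp only [br, mul_sub, sub_mul, ← mul_assoc]
  abel

theorem br_lcs_lcs {k : ℕ} (hk : 1 ≤ k) : ∀ {j : ℕ}, 1 ≤ j → ∀ {x y : A},
    x ∈ lcs K A j → y ∈ lcs K A k → br x y ∈ lcs K A (j + k) := by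
  induction k, hk using Nat.le_induction with
  | base => exact fun hj x y hx _ => br_mem_lcs' hj y hx
  | succ k hk ih =>
    intro j hj x y hx hy
    rw [← brL_apply (K := K)]
    refine lcs_induct hk _ _ (fun a l hl => ?_) hy
    rw [brL_apply, br_jacobi]
    refine Submodule.add_mem _ ?_ ?_
    · have := ih (j := j + 1) (by omega) (br_mem_lcs' hj a hx) hl
      rwa [show j + 1 + k = j + (k + 1) by omega] at this
    · exact br_mem_lcs (k := j + k) (by omega) a (ih hj hx hl)

theorem br_of_br {r : ℕ} (z : A) (hz : ∀ a : A, br z a ∈ lcs K A (r + 1)) {k : ℕ}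
    (hk : 1 ≤ k) : ∀ {y : A}, y ∈ lcs K A k → br z y ∈ lcs K A (r + k) := by
  induction k, hk using Nat.le_induction with
  | base => exact fun _ => hz _
  | succ k hk ih =>
    intro y hy
    rw [← brL_apply (K := K)]
    refine lcs_induct hk _ _ (fun a l hl => ?_) hy
    rw [brL_apply, br_jacobi]
    refine Submodule.add_mem _ ?_ ?_
    · have := br_lcs_lcs hk (by omega) (hz a) hl
      rwa [show r + 1 + k = r + (k + 1) by omega] at this
    · exact br_mem_lcs (k := r + k) (by omega) a (ih hl)

theorem br_mul_right_of_left {j : ℕ} (hj : 1 ≤ j) {l : A} (hl : l ∈ lcs K A j)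
    (h : ∀ a b : A, br (a * l) b ∈ lcs K A (j + 1)) (a b : A) :
    br (l * a) b ∈ lcs K A (j + 1) := by
  have e : br (l * a) b = br (a * l) b - br (br a l) b := by
    simp only [br, mul_sub, sub_mul, ← mul_assoc]
    abel
  rw [e]
  exact Submodule.sub_mem _ (h a b)
    (lcs_anti (by omega) (br_mem_lcs' (by omega) b (br_mem_lcs hj a hl)))

theorem br_odd [CharZero K] (n : ℕ) : ∀ {l : A}, l ∈ lcs K A (2 * n + 1) → ∀ a b : A,
    br (a * l) b ∈ lcs K A (2 * n + 1 + 1) := by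
  induction n with
  | zero => exact fun _ a b => br_mem_lcs' (by omega) b Submodule.mem_top
  | succ n ih =>
    intro l hl a b
    have aux : ∀ l : A, l ∈ lcs K A (2 * n + 1) → ∀ a p q b : A,
        br (a * br q (br p l)) b ∈ lcs K A (2 * n + 1 + 1 + 1 + 1) := by
      intro l hl a p q b
      have up : ∀ m : A, (∀ c : A, br m c ∈ lcs K A (2 * n + 1 + 1)) → ∀ x y z : A,
          br x (br y (br z m)) ∈ lcs K A (2 * n + 1 + 1 + 1 + 1) := by
        intro m hm x y z
        refine br_mem_lcs (by omega) x (br_mem_lcs (by omega) y ?_)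
        rw [br_swap]
        exact Submodule.neg_mem _ (hm z)
      refine key_mem K _ l ?_ ?_ ?_ a p q b
      · exact up l (fun c => br_mem_lcs' (by omega) c hl)
      · exact fun x y z w => up _ (ih hl w) x y z
      · exact fun x y z w => up _ (br_mul_right_of_left (by omega) hl (fun a b => ih hl a b) w) x y z
    have step : ∀ q l' : A, l' ∈ lcs K A (2 * n + 1 + 1) →
        br (a * br q l') b ∈ lcs K A (2 * n + 1 + 1 + 1 + 1) := by
      intro q l' hl'
      have := lcs_induct (k := 2 * n + 1) (by omega)
        (-(brL K b ∘ₗ LinearMap.mulLeft K a ∘ₗ brL K q)) (lcs K A (2 * n + 1 + 1 + 1 + 1))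
        (fun p l hl => by
          have := aux l hl a p q b
          rw [br_swap] at this
          simpa [brL_apply] using this) hl'
      rw [br_swap]
      simpa [brL_apply] using this
    have := lcs_induct (k := 2 * n + 1 + 1) (by omega)
        (-(brL K b ∘ₗ LinearMap.mulLeft K a)) (lcs K A (2 * n + 1 + 1 + 1 + 1))
        (fun q l' hl' => by
          have := step q l' hl'
          rw [br_swap] at this
          simpa [brL_apply] using this) hl
    rw [br_swap, show 2 * (n + 1) + 1 + 1 = 2 * n + 1 + 1 + 1 + 1 by omega]
    simpa [brL_apply] using this

theorem mem_mIdeal {j : ℕ} {l : A} (hl : l ∈ lcs K A j) (a b : A) :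
    a * l * b ∈ mIdeal K A j := Submodule.subset_span ⟨a, l, b, hl, rfl⟩

end LcsLemmas

/-- In the free associative algebra over a field of characteristic zero,
`L_j · L_k ⊆ M_{j+k-1}` whenever `j` or `k` is odd. -/
theorem lcs_mul_lcs_subset_mIdeal
    (K : Type*) [Field K] [CharZero K] (X : Type*)
    (j k : ℕ) (hj1 : 1 ≤ j) (hk1 : 1 ≤ k) (hodd : Odd j ∨ Odd k)
    (x : FreeAlgebra K X) (hx : x ∈ lcs K (FreeAlgebra K X) j)
    (y : FreeAlgebra K X) (hy : y ∈ lcs K (FreeAlgebra K X) k) :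
    x * y ∈ mIdeal K (FreeAlgebra K X) (j + k - 1) := by
  rcases hodd with ⟨n, rfl⟩ | ⟨n, rfl⟩
  · rcases Nat.lt_or_ge 1 k with hk | hk
    · obtain ⟨k, rfl⟩ : ∃ m, k = m + 1 := ⟨k - 1, by omega⟩
      refine lcs_induct (by omega) (LinearMap.mulLeft K x) _ (fun a v hv => ?_) hy
      rw [show 2 * n + 1 + (k + 1) - 1 = 2 * n + 1 + k by omega, LinearMap.mulLeft_apply]
      have e : x * br a v = 1 * br (x * a) v * 1 - 1 * br x v * a := by
        simp only [br, mul_sub, sub_mul, ← mul_assoc, one_mul, mul_one]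
        abel
      rw [e]
      refine Submodule.sub_mem _ (mem_mIdeal ?_ _ _) (mem_mIdeal ?_ _ _)
      · exact br_of_br _ (br_mul_right_of_left (by omega) hx (br_odd n hx) a) (by omega) hv
      · exact br_lcs_lcs (by omega) (by omega) hx hv
    · obtain rfl : k = 1 := by omega
      simpa using mem_mIdeal hx 1 y
  · rcases Nat.lt_or_ge 1 j with hj | hj
    · obtain ⟨j, rfl⟩ : ∃ m, j = m + 1 := ⟨j - 1, by omega⟩
      refine lcs_induct (by omega) (LinearMap.mulRight K y) _ (fun a v hv => ?_) hx
      rw [show j + 1 + (2 * n + 1) - 1 = 2 * n + 1 + j by omega, LinearMap.mulRight_apply]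
      have e : br a v * y = 1 * br (a * y) v * 1 - a * br y v * 1 := by
        simp only [br, mul_sub, sub_mul, ← mul_assoc, one_mul, mul_one]
        abel
      rw [e]
      refine Submodule.sub_mem _ (mem_mIdeal ?_ _ _) (mem_mIdeal ?_ _ _)
      · exact br_of_br _ (br_odd n hy a) (by omega) hv
      · exact br_lcs_lcs (by omega) (by omega) hy hv
    · obtain rfl : j = 1 := by omega
      rw [show 1 + (2 * n + 1) - 1 = 2 * n + 1 by omega]
      simpa using mem_mIdeal hy x 1
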